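/- For every α ∈ (0,2), the function Φ_α(θ) = ∫₀^∞ [ (t^{4/(α+2)} - 2 cos θ · t^{2/(α+2)} + 1)^{-α/2} - t^{-2α/(α+2)} ] dt is well defined (the integral converges for every θ ∈ (0, 2π) with cos θ < 1, and for θ with cos θ = 1 it may equal +∞ only when α ≥ 1... restrict to θ ≠ 0 mod 2π), and its average over the circle is negative: ∫₀^{2π} Φ_α(θ) dθ < 0. -/

import Mathlib

open Set MeasureTheory Real

lemma multichoose_succ_mul (a : ℝ) (n : ℕ) :
    Ring.multichoose a (n + 1) * (n + 1) = Ring.multichoose a n * (a + n) := by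
  have h0 := Ring.factorial_nsmul_multichoose_eq_ascPochhammer a n
  have h1 := Ring.factorial_nsmul_multichoose_eq_ascPochhammer a (n + 1)
  rw [Polynomial.ascPochhammer_smeval_eq_eval, nsmul_eq_mul] at h0 h1
  rw [ascPochhammer_succ_eval, ← h0, Nat.factorial_succ] at h1
  push_cast at h1
  have hn : (n.factorial : ℝ) ≠ 0 := by positivity
  apply mul_left_cancel₀ hn
  linarith

lemma multichoose_pos {a : ℝ} (ha : 0 < a) (n : ℕ) : 0 < Ring.multichoose a n := by
  induction n with
  | zero => simp
  | succ n ih =>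
    have h := multichoose_succ_mul a n
    have : 0 < Ring.multichoose a n * (a + n) := by positivity
    rw [← h] at this
    exact pos_of_mul_pos_left this (by positivity)

lemma hasSum_one_sub_cpow_neg (a : ℝ) {z : ℂ} (hz : ‖z‖ < 1) :
    HasSum (fun n : ℕ => ((Ring.multichoose a n : ℝ) : ℂ) * z ^ n) (1 / (1 - z) ^ (a : ℂ)) := by
  have h := (Complex.one_div_one_sub_cpow_hasFPowerSeriesOnBall_zero a).hasSum (y := z)
    (by simpa [enorm_eq_nnnorm, ← NNReal.coe_lt_coe] using hz)
  have e : ∀ n : ℕ, Ring.choose ((a : ℂ) + n - 1) n = ((Ring.multichoose a n : ℝ) : ℂ) := by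
    intro n
    refine Eq.trans ?_ (Ring.map_multichoose (algebraMap ℝ ℂ) a n).symm
    simp only [Ring.choose, Complex.coe_algebraMap]
    congr 1
    ring
  simpa [FormalMultilinearSeries.ofScalars, e] using h

lemma norm_one_sub_polar_sq (r θ : ℝ) :
    ‖(1 : ℂ) - r * Complex.exp (θ * Complex.I)‖ ^ 2 = r ^ 2 - 2 * cos θ * r + 1 := by
  rw [← Complex.normSq_eq_norm_sq, Complex.normSq_apply]
  simp [Complex.exp_ofReal_mul_I_re, Complex.exp_ofReal_mul_I_im]
  nlinarith [Real.sin_sq_add_cos_sq θ]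

lemma integral_exp_int_mul_I (n : ℤ) :
    ∫ θ in (0 : ℝ)..2 * π, Complex.exp (n * θ * Complex.I) = if n = 0 then 2 * (π : ℂ) else 0 := by
  split_ifs with h
  · simp [h]
  · have : ∀ θ : ℝ, Complex.exp (n * θ * Complex.I) = Complex.exp ((n * Complex.I) * θ) := by
      intro θ; ring_nf
    simp_rw [this]
    rw [integral_exp_mul_complex (by simp [h])]
    have : Complex.exp (n * Complex.I * ↑(2 * π)) = 1 := by
      rw [Complex.exp_eq_one_iff]; exact ⟨n, by push_cast; ring⟩
    rw [this]
    simp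

lemma hasSum_mul_conj {f : ℕ → ℂ} {s : ℂ} (hf : HasSum f s) :
    HasSum (fun p : ℕ × ℕ => f p.1 * star (f p.2)) ((‖s‖ ^ 2 : ℝ) : ℂ) := by
  have hconj : HasSum (fun n => star (f n)) (star s) := hf.star
  have hnorm : Summable fun n => ‖star (f n)‖ := by simpa using hf.summable.norm
  rw [← Complex.normSq_eq_norm_sq, ← Complex.mul_conj, ← Complex.star_def]
  generalize star s = t at hconj
  generalize hg : (fun n => star (f n)) = g at hconj hnorm
  have h := hf.mul hconj (summable_mul_of_summable_norm hf.summable.norm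
    (by simpa [← hg] using hnorm))
  simpa [← hg] using h

/-- Parseval's identity for absolutely convergent power series with real coefficients. -/
lemma hasSum_integral_norm_sq {c : ℕ → ℝ} (hc : Summable fun n => |c n|) {h : ℝ → ℂ}
    (hh : ∀ θ : ℝ, HasSum (fun n : ℕ => (c n : ℂ) * Complex.exp (n * θ * Complex.I)) (h θ)) :
    HasSum (fun n => 2 * π * c n ^ 2) (∫ θ in (0 : ℝ)..2 * π, ‖h θ‖ ^ 2) := by
  let F : ℕ × ℕ → ℝ → ℂ := fun p θ =>
    (c p.1 * c p.2 : ℝ) * Complex.exp (((p.1 : ℤ) - (p.2 : ℤ) : ℤ) * θ * Complex.I)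
  have hF : ∀ θ, HasSum (fun p => F p θ) ((‖h θ‖ ^ 2 : ℝ) : ℂ) := by
    intro θ
    convert hasSum_mul_conj (hh θ) using 1
    ext p
    have hexp : Complex.exp (((p.1 : ℤ) - (p.2 : ℤ) : ℤ) * θ * Complex.I) =
        Complex.exp (p.1 * θ * Complex.I) * Complex.exp (-(p.2 * θ * Complex.I)) := by
      rw [← Complex.exp_add]; push_cast; ring_nf
    have hconj : (starRingEnd ℂ) (Complex.exp (p.2 * θ * Complex.I)) =
        Complex.exp (-(p.2 * θ * Complex.I)) := by
      rw [← Complex.exp_conj]; simp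
    simp only [F]
    rw [Complex.star_def, map_mul, hconj, hexp, Complex.conj_ofReal]
    push_cast
    ring
  have key : HasSum (fun p => ∫ θ in (0 : ℝ)..2 * π, F p θ)
      (∫ θ in (0 : ℝ)..2 * π, ((‖h θ‖ ^ 2 : ℝ) : ℂ)) := by
    have hsum : Summable fun p : ℕ × ℕ => |c p.1| * |c p.2| :=
      hc.mul_of_nonneg hc (fun n => abs_nonneg _) (fun n => abs_nonneg _)
    refine intervalIntegral.hasSum_integral_of_dominated_convergence
      (fun p _ => |c p.1| * |c p.2|) ?_ ?_ ?_ ?_ ?_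
    · intro p
      exact (by fun_prop : Continuous (F p)).aestronglyMeasurable
    · intro p
      refine Filter.Eventually.of_forall fun θ _ => ?_
      have : ‖Complex.exp (((p.1 : ℤ) - (p.2 : ℤ) : ℤ) * θ * Complex.I)‖ = 1 := by
        rw [← Complex.norm_exp_ofReal_mul_I (((p.1 : ℤ) - (p.2 : ℤ) : ℤ) * θ)]; push_cast; rfl
      simp only [F]
      rw [norm_mul, this, Complex.norm_real]
      simp
    · exact Filter.Eventually.of_forall fun θ _ => hsum
    · exact intervalIntegrable_const
    · exact Filter.Eventually.of_forall fun θ _ => hF θ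
  have hint : ∀ p : ℕ × ℕ, ∫ θ in (0 : ℝ)..2 * π, F p θ
      = ((if p.1 = p.2 then 2 * π * c p.1 ^ 2 else 0 : ℝ) : ℂ) := by
    intro p
    simp only [F]
    rw [intervalIntegral.integral_const_mul, integral_exp_int_mul_I]
    by_cases h : p.1 = p.2
    · simp [h]; ring
    · have : ¬ ((p.1 : ℤ) - p.2 = 0) := by omega
      simp [h, this]
  simp_rw [hint] at key
  rw [intervalIntegral.integral_ofReal] at key
  replace key := Complex.hasSum_ofReal.1 key
  have hinj : Function.Injective (fun n : ℕ => (n, n)) := fun m n h => (Prod.ext_iff.1 h).1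
  rw [← hinj.hasSum_iff] at key
  · simpa [Function.comp_def] using key
  · rintro ⟨m, n⟩ h
    have : m ≠ n := fun e => h ⟨m, by simp [e]⟩
    simp [this]

lemma hasSum_integral_rpow_neg (a : ℝ) {r : ℝ} (hr0 : 0 ≤ r) (hr1 : r < 1) :
    HasSum (fun n : ℕ => 2 * π * (Ring.multichoose a n * r ^ n) ^ 2)
      (∫ θ in (0 : ℝ)..2 * π, (r ^ 2 - 2 * cos θ * r + 1) ^ (-a)) := by
  have hs (θ : ℝ) := hasSum_one_sub_cpow_neg a (z := r * Complex.exp (θ * Complex.I))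
    (by simpa [Complex.norm_exp_ofReal_mul_I, abs_of_nonneg hr0] using hr1)
  have hc : Summable fun n : ℕ => |Ring.multichoose a n * r ^ n| := by
    simpa [abs_mul] using (hs 0).summable.norm
  convert hasSum_integral_norm_sq hc
    (h := fun θ => 1 / (1 - r * Complex.exp (θ * Complex.I)) ^ (a : ℂ)) ?_ using 1
  · refine intervalIntegral.integral_congr fun θ _ => ?_
    rw [norm_div, norm_one, Complex.norm_cpow_real, ← norm_one_sub_polar_sq, ← Real.rpow_natCast,
      ← Real.rpow_mul (norm_nonneg _), one_div, inv_pow, ← Real.rpow_natCast (_ ^ a),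
      ← Real.rpow_mul (norm_nonneg _), ← Real.rpow_neg (norm_nonneg _)]
    congr 1
    push_cast; ring
  · intro θ
    convert hs θ using 2 with n
    rw [mul_pow, ← Complex.exp_nat_mul, mul_assoc (n : ℂ)]
    push_cast
    ring

lemma multichoose_sq_add_sq_div_lt {a : ℝ} (ha0 : 0 < a) (ha1 : a < 1) (n : ℕ) :
    (Ring.multichoose a n ^ 2 + Ring.multichoose a (n + 1) ^ 2) / (2 * n + a + 1) <
      (Ring.multichoose a n ^ 2 - Ring.multichoose a (n + 1) ^ 2) / (1 - a) := by
  have hc := multichoose_pos ha0 n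
  have hn : (0 : ℝ) ≤ n := n.cast_nonneg
  have h : Ring.multichoose a (n + 1) = Ring.multichoose a n * (a + n) / (n + 1) := by
    rw [eq_div_iff (by positivity), multichoose_succ_mul]
  rw [h, div_lt_div_iff₀ (by positivity) (by linarith), ← sub_pos]
  have e : (Ring.multichoose a n ^ 2 - (Ring.multichoose a n * (a + n) / (n + 1)) ^ 2)
        * (2 * n + a + 1) -
      (Ring.multichoose a n ^ 2 + (Ring.multichoose a n * (a + n) / (n + 1)) ^ 2) * (1 - a) =
      2 * Ring.multichoose a n ^ 2 * (1 - a) * (a + n) / (n + 1) := by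
    field_simp
    ring
  rw [e]
  have : 0 < 1 - a := by linarith
  positivity

lemma tsum_multichoose_sq_lt {a : ℝ} (ha0 : 0 < a) (ha1 : a < 1) :
    Summable (fun n : ℕ => Ring.multichoose a n ^ 2 / (2 * n + a + 1)) ∧
    Summable (fun n : ℕ => Ring.multichoose a (n + 1) ^ 2 / (2 * n + a + 1)) ∧
    ∑' n : ℕ, Ring.multichoose a n ^ 2 / (2 * n + a + 1) +
      ∑' n : ℕ, Ring.multichoose a (n + 1) ^ 2 / (2 * n + a + 1) < 1 / (1 - a) := by
  set c : ℕ → ℝ := Ring.multichoose a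
  have hc0 : c 0 = 1 := Ring.multichoose_zero_right a
  have hlt : ∀ n : ℕ, (c n ^ 2 + c (n + 1) ^ 2) / (2 * n + a + 1) <
      (c n ^ 2 - c (n + 1) ^ 2) / (1 - a) := multichoose_sq_add_sq_div_lt ha0 ha1
  have ha : 0 < 1 - a := by linarith
  let x : ℕ → ℝ := fun n => (c n ^ 2 + c (n + 1) ^ 2) / (2 * n + a + 1)
  have hx : ∀ n, 0 ≤ x n := fun n => by positivity
  have hxv : ∀ n : ℕ, c n ^ 2 / (2 * n + a + 1) ≤ x n := fun n => by
    simp only [x]; gcongr; nlinarith [sq_nonneg (c (n + 1))]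
  have hxw : ∀ n : ℕ, c (n + 1) ^ 2 / (2 * n + a + 1) ≤ x n := fun n => by
    simp only [x]; gcongr; nlinarith [sq_nonneg (c n)]
  have hpart : ∀ N : ℕ, ∑ n ∈ Finset.range N, x (n + 1) ≤ (c 1 ^ 2 - c (N + 1) ^ 2) / (1 - a) := by
    intro N
    induction N with
    | zero => simp
    | succ N ih =>
      rw [Finset.sum_range_succ]
      calc _ ≤ (c 1 ^ 2 - c (N + 1) ^ 2) / (1 - a) +
            (c (N + 1) ^ 2 - c (N + 1 + 1) ^ 2) / (1 - a) := add_le_add ih (hlt (N + 1)).le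
        _ = _ := by ring
  have hpart' : ∀ N : ℕ, ∑ n ∈ Finset.range N, x (n + 1) ≤ c 1 ^ 2 / (1 - a) := fun N =>
    (hpart N).trans (by gcongr; nlinarith [sq_nonneg (c (N + 1))])
  have hxs' : Summable fun n => x (n + 1) :=
    summable_of_sum_range_le (fun n => hx (n + 1)) hpart'
  have hxs : Summable x := (summable_nat_add_iff 1).1 hxs'
  have hv : Summable fun n : ℕ => c n ^ 2 / (2 * n + a + 1) :=
    hxs.of_nonneg_of_le (fun n => by positivity) hxv
  have hw : Summable fun n : ℕ => c (n + 1) ^ 2 / (2 * n + a + 1) :=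
    hxs.of_nonneg_of_le (fun n => by positivity) hxw
  refine ⟨hv, hw, ?_⟩
  rw [← hv.tsum_add hw]
  calc _ = ∑' n, x n := by simp only [x, add_div]
    _ = x 0 + ∑' n, x (n + 1) := hxs.tsum_eq_zero_add
    _ < (c 0 ^ 2 - c 1 ^ 2) / (1 - a) + c 1 ^ 2 / (1 - a) :=
      add_lt_add_of_lt_of_le (hlt 0) (hxs'.tsum_le_of_sum_range_le hpart')
    _ = 1 / (1 - a) := by rw [hc0]; ring

lemma integrable_and_hasSum_integral_of_nonneg {X : Type*} [MeasurableSpace X] {μ : Measure X}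
    {F : ℕ → X → ℝ} {f : X → ℝ} (hF : ∀ n, Integrable (F n) μ) (hF0 : ∀ n, 0 ≤ᵐ[μ] F n)
    (hf : ∀ᵐ x ∂μ, HasSum (fun n => F n x) (f x)) (hs : Summable fun n => ∫ x, F n x ∂μ) :
    Integrable f μ ∧ ∫ x, f x ∂μ = ∑' n, ∫ x, F n x ∂μ := by
  have hfeq : (fun x => ∑' n, F n x) =ᵐ[μ] f := hf.mono fun x hx => hx.tsum_eq
  have hnorm : ∀ n, ∫ x, ‖F n x‖ ∂μ = ∫ x, F n x ∂μ := fun n =>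
    integral_congr_ae ((hF0 n).mono fun x hx => by simpa using hx)
  refine ⟨⟨?_, ?_⟩, ?_⟩
  · refine aestronglyMeasurable_of_tendsto_ae Filter.atTop
      (f := fun N x => ∑ n ∈ Finset.range N, F n x)
      (fun N => (integrable_finsetSum _ fun n _ => hF n).aestronglyMeasurable)
      (hf.mono fun x hx => hx.tendsto_sum_nat)
  · have h0 : ∀ᵐ x ∂μ, ∀ n, 0 ≤ F n x := ae_all_iff.2 hF0
    have heq : ∀ᵐ x ∂μ, ‖f x‖ₑ = ∑' n, ENNReal.ofReal (F n x) := by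
      filter_upwards [h0, hf] with x hx hfx
      rw [← ENNReal.ofReal_tsum_of_nonneg hx hfx.summable, hfx.tsum_eq,
        Real.enorm_of_nonneg (hfx.nonneg hx)]
    rw [hasFiniteIntegral_iff_enorm, lintegral_congr_ae heq,
      lintegral_tsum fun n => (hF n).aestronglyMeasurable.aemeasurable.ennreal_ofReal]
    simp_rw [← fun n => ofReal_integral_eq_lintegral_ofReal (hF n) (hF0 n)]
    rw [← ENNReal.ofReal_tsum_of_nonneg (fun n => integral_nonneg_of_ae (hF0 n)) hs]
    exact ENNReal.ofReal_lt_top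
  · rw [← integral_congr_ae hfeq]
    exact (hasSum_integral_of_summable_integral_norm hF (by simpa only [hnorm] using hs)).tsum_eq.symm

/-- The integrand of the displacement potential differential for the exponent `2 * a`. -/
noncomputable def displacementKernel (a θ t : ℝ) : ℝ :=
  ((t ^ (1 / (a + 1))) ^ 2 - 2 * cos θ * t ^ (1 / (a + 1)) + 1) ^ (-a) - t ^ (-(2 * a / (a + 1)))

lemma quadratic_cos_lower (θ : ℝ) {s : ℝ} (hs : 0 ≤ s) :
    (1 - cos θ) / 2 ≤ s ^ 2 - 2 * cos θ * s + 1 := by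
  have h1 := cos_le_one θ
  have h2 := neg_one_le_cos θ
  rcases le_total (cos θ) 0 with h0 | h0
  · nlinarith [mul_nonneg (neg_nonneg.2 h0) hs]
  · nlinarith [sq_nonneg (s - cos θ)]

lemma quadratic_cos_pos (θ : ℝ) {s : ℝ} (hs : 0 ≤ s) (hs1 : s ≠ 1) :
    0 < s ^ 2 - 2 * cos θ * s + 1 := by
  have : 0 < (s - 1) ^ 2 := by
    have := sub_ne_zero.2 hs1
    positivity
  nlinarith [cos_le_one θ, mul_nonneg hs (sub_nonneg.2 (cos_le_one θ))]

lemma abs_quadratic_cos_sub_one_le (θ : ℝ) {s : ℝ} (hs : 0 ≤ s) (hs1 : s ≤ 1) :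
    |s ^ 2 - 2 * cos θ * s + 1 - 1| ≤ 3 * s := by
  rw [abs_le]
  constructor <;> nlinarith [cos_le_one θ, neg_one_le_cos θ,
    mul_nonneg hs (sub_nonneg.2 (cos_le_one θ)),
    mul_nonneg hs (sub_nonneg.2 (neg_one_le_cos θ)), mul_nonneg hs (sub_nonneg.2 hs1)]

lemma one_sub_mul_le_rpow_neg {a w : ℝ} (ha0 : 0 ≤ a) (ha1 : a ≤ 1) (hw : 0 < w) :
    1 - a * (w - 1) ≤ w ^ (-a) := by
  have h := rpow_one_add_le_one_add_mul_self (s := w - 1) (by linarith) ha0 ha1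
  rw [add_sub_cancel] at h
  have hp : 0 < w ^ a := rpow_pos_of_pos hw a
  rw [rpow_neg hw.le, ← one_div, le_div_iff₀ hp]
  rcases le_total 0 (1 - a * (w - 1)) with h0 | h0
  · nlinarith [mul_le_mul_of_nonneg_left h h0, sq_nonneg (a * (w - 1))]
  · nlinarith [mul_nonneg (neg_nonneg.2 h0) hp.le]

lemma rpow_neg_le_one_add_mul {a w : ℝ} (ha0 : 0 ≤ a) (ha1 : a ≤ 1) (hw : 0 < w) :
    w ^ (-a) ≤ 1 + a * ((1 - w) / w) := by
  have hw' : 0 < w⁻¹ := inv_pos.2 hw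
  have h := rpow_one_add_le_one_add_mul_self (s := w⁻¹ - 1) (by linarith) ha0 ha1
  rw [add_sub_cancel, inv_rpow hw.le, ← rpow_neg hw.le] at h
  have e : (1 - w) / w = w⁻¹ - 1 := by field_simp
  rwa [e]

lemma displacementKernel_eq_mul {a t : ℝ} (ht : 0 < t) (θ : ℝ) :
    displacementKernel a θ t = t ^ (-(2 * a / (a + 1))) *
      (((t ^ (-(1 / (a + 1)))) ^ 2 - 2 * cos θ * t ^ (-(1 / (a + 1))) + 1) ^ (-a) - 1) := by
  unfold displacementKernel
  set r := t ^ (1 / (a + 1)) with hr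
  have hr0 : 0 < r := rpow_pos_of_pos ht _
  have hs : t ^ (-(1 / (a + 1))) = r⁻¹ := rpow_neg ht.le _
  have hq : t ^ (-(2 * a / (a + 1))) = (r ^ 2) ^ (-a) := by
    rw [hr, ← rpow_natCast, ← rpow_mul ht.le, ← rpow_mul ht.le]
    congr 1
    push_cast
    ring
  have hy : r ^ 2 - 2 * cos θ * r + 1 = r ^ 2 * (r⁻¹ ^ 2 - 2 * cos θ * r⁻¹ + 1) := by
    field_simp
    ring
  have hnn : 0 ≤ r⁻¹ ^ 2 - 2 * cos θ * r⁻¹ + 1 := by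
    nlinarith [quadratic_cos_lower θ (inv_nonneg.2 hr0.le), cos_le_one θ]
  rw [hs, hq, hy, mul_rpow (by positivity) hnn]
  ring

lemma rpow_neg_mul_rpow_neg {a t : ℝ} (ha : 0 < a) (ht : 0 < t) :
    t ^ (-(2 * a / (a + 1))) * t ^ (-(1 / (a + 1))) = t ^ (-((2 * a + 1) / (a + 1))) := by
  rw [← rpow_add ht]
  congr 1
  field_simp
  ring

lemma neg_le_displacementKernel_of_one_lt {a t : ℝ} (ha0 : 0 < a) (ha1 : a < 1) (ht : 1 < t)
    (θ : ℝ) : -(3 * t ^ (-((2 * a + 1) / (a + 1)))) ≤ displacementKernel a θ t := by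
  have ht0 : 0 < t := by linarith
  rw [displacementKernel_eq_mul ht0, ← rpow_neg_mul_rpow_neg ha0 ht0]
  set s := t ^ (-(1 / (a + 1))) with hs
  have hs0 : 0 < s := rpow_pos_of_pos ht0 _
  have hs1 : s < 1 := rpow_lt_one_of_one_lt_of_neg ht (neg_neg_of_pos (by positivity))
  have hw := quadratic_cos_pos θ hs0.le hs1.ne
  have h1 := one_sub_mul_le_rpow_neg ha0.le ha1.le hw
  have h2 := abs_le.1 (abs_quadratic_cos_sub_one_le θ hs0.le hs1.le)
  have hq : 0 < t ^ (-(2 * a / (a + 1))) := rpow_pos_of_pos ht0 _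
  have h3 : -(3 * s) ≤ (s ^ 2 - 2 * cos θ * s + 1) ^ (-a) - 1 := by
    nlinarith [mul_le_mul_of_nonneg_left h2.2 ha0.le, mul_pos hs0 (sub_pos.2 ha1)]
  nlinarith [mul_le_mul_of_nonneg_left h3 hq.le]

lemma displacementKernel_le_of_one_lt {a t θ : ℝ} (ha0 : 0 < a) (ha1 : a < 1) (ht : 1 < t)
    (hθ : cos θ < 1) :
    displacementKernel a θ t ≤ 6 / (1 - cos θ) * t ^ (-((2 * a + 1) / (a + 1))) := by
  have ht0 : 0 < t := by linarith
  rw [displacementKernel_eq_mul ht0, ← rpow_neg_mul_rpow_neg ha0 ht0]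
  set s := t ^ (-(1 / (a + 1))) with hs
  have hs0 : 0 < s := rpow_pos_of_pos ht0 _
  have hs1 : s < 1 := rpow_lt_one_of_one_lt_of_neg ht (neg_neg_of_pos (by positivity))
  have hw := quadratic_cos_pos θ hs0.le hs1.ne
  have hδ : 0 < 1 - cos θ := by linarith
  have hwδ := quadratic_cos_lower θ hs0.le
  have h1 := rpow_neg_le_one_add_mul ha0.le ha1.le hw
  have h2 := abs_le.1 (abs_quadratic_cos_sub_one_le θ hs0.le hs1.le)
  set w := s ^ 2 - 2 * cos θ * s + 1
  have hq : 0 < t ^ (-(2 * a / (a + 1))) := rpow_pos_of_pos ht0 _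
  have h3 : a * ((1 - w) / w) ≤ 6 / (1 - cos θ) * s := by
    have h4 : (1 - w) / w ≤ 3 * s / ((1 - cos θ) / 2) :=
      div_le_div₀ (by positivity) (by linarith) (by positivity) hwδ
    have h5 : 3 * s / ((1 - cos θ) / 2) = 6 / (1 - cos θ) * s := by field_simp; ring
    rw [h5] at h4
    have h6 : 0 < 6 / (1 - cos θ) * s := by positivity
    nlinarith
  nlinarith [mul_le_mul_of_nonneg_left (h1.trans (add_le_add_right h3 1)) hq.le]

lemma neg_le_displacementKernel {a t : ℝ} (ht : 0 < t) (θ : ℝ) :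
    -t ^ (-(2 * a / (a + 1))) ≤ displacementKernel a θ t := by
  have hr0 : 0 < t ^ (1 / (a + 1)) := rpow_pos_of_pos ht _
  have hnn := quadratic_cos_lower θ hr0.le
  have := rpow_nonneg (x := (t ^ (1 / (a + 1))) ^ 2 - 2 * cos θ * t ^ (1 / (a + 1)) + 1)
    (by linarith [cos_le_one θ]) (-a)
  unfold displacementKernel
  linarith

lemma measurable_displacementKernel (a : ℝ) :
    Measurable (Function.uncurry (displacementKernel a)) := by
  unfold displacementKernel Function.uncurry
  fun_prop

lemma integrableOn_rpow_Ioo {e : ℝ} (he : -1 < e) :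
    IntegrableOn (fun t : ℝ => t ^ e) (Ioo 0 1) :=
  (intervalIntegral.integrableOn_Ioo_rpow_iff one_pos).2 he

lemma integral_rpow_Ioo {e : ℝ} (he : -1 < e) : ∫ t in Ioo (0 : ℝ) 1, t ^ e = 1 / (e + 1) := by
  rw [← integral_Ioc_eq_integral_Ioo, ← intervalIntegral.integral_of_le zero_le_one,
    integral_rpow (Or.inl he), one_rpow, zero_rpow (by linarith), sub_zero]

lemma neg_one_lt_exponent {a : ℝ} (ha0 : 0 < a) (ha1 : a < 1) : -1 < -(2 * a / (a + 1)) := by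
  rw [neg_lt_neg_iff, div_lt_one (by linarith)]
  linarith

lemma exponent_lt_neg_one {a : ℝ} (ha0 : 0 < a) : -((2 * a + 1) / (a + 1)) < -1 := by
  rw [neg_lt_neg_iff, one_lt_div (by linarith)]
  linarith

lemma integrableOn_Ioi_zero {f : ℝ → ℝ} (h0 : IntegrableOn f (Ioo 0 1))
    (h1 : IntegrableOn f (Ioi 1)) : IntegrableOn f (Ioi 0) := by
  rw [← Ioc_union_Ioi_eq_Ioi (zero_le_one (α := ℝ))]
  exact ((integrableOn_Ioc_iff_integrableOn_Ioo).2 h0).union h1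

lemma integrableOn_displacementKernel {a θ : ℝ} (ha0 : 0 < a) (ha1 : a < 1) (hθ : cos θ < 1) :
    IntegrableOn (displacementKernel a θ) (Ioi 0) := by
  have hm : Measurable (displacementKernel a θ) :=
    (measurable_displacementKernel a).of_uncurry_left
  have hδ : 0 < (1 - cos θ) / 2 := by linarith
  refine integrableOn_Ioi_zero ?_ ?_
  · refine Integrable.mono' (g := fun t => ((1 - cos θ) / 2) ^ (-a) + t ^ (-(2 * a / (a + 1))))
      ((integrableOn_const (by simp)).add (integrableOn_rpow_Ioo (neg_one_lt_exponent ha0 ha1)))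
      hm.aestronglyMeasurable ?_
    refine ae_restrict_of_forall_mem measurableSet_Ioo fun t ht => ?_
    have hlow := neg_le_displacementKernel (a := a) ht.1 θ
    have hr0 : 0 < t ^ (1 / (a + 1)) := rpow_pos_of_pos ht.1 _
    have hup := rpow_le_rpow_of_nonpos hδ (quadratic_cos_lower θ hr0.le) (neg_nonpos.2 ha0.le)
    have hq : 0 < t ^ (-(2 * a / (a + 1))) := rpow_pos_of_pos ht.1 _
    have hp : 0 < ((1 - cos θ) / 2) ^ (-a) := rpow_pos_of_pos hδ _
    rw [norm_eq_abs, abs_le]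
    refine ⟨by linarith, ?_⟩
    unfold displacementKernel
    linarith
  · refine Integrable.mono'
      (g := fun t => (3 + 6 / (1 - cos θ)) * t ^ (-((2 * a + 1) / (a + 1))))
      ((integrableOn_Ioi_rpow_of_lt (exponent_lt_neg_one ha0) one_pos).const_mul _)
      hm.aestronglyMeasurable ?_
    refine ae_restrict_of_forall_mem measurableSet_Ioi fun t ht => ?_
    have hlow := neg_le_displacementKernel_of_one_lt ha0 ha1 ht θ
    have hup := displacementKernel_le_of_one_lt ha0 ha1 ht hθ
    have hq : 0 < t ^ (-((2 * a + 1) / (a + 1))) :=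
      rpow_pos_of_pos (zero_lt_one.trans ht) _
    have hc : 0 < 6 / (1 - cos θ) := div_pos (by norm_num) (by linarith)
    have := mul_pos hc hq
    rw [norm_eq_abs, abs_le]
    constructor <;> nlinarith

lemma continuous_quadratic_cos_rpow (a : ℝ) {s : ℝ} (hs : 0 ≤ s) (hs1 : s ≠ 1) :
    Continuous fun θ : ℝ => (s ^ 2 - 2 * cos θ * s + 1) ^ (-a) :=
  (by fun_prop : Continuous fun θ : ℝ => s ^ 2 - 2 * cos θ * s + 1).rpow_const
    fun θ => Or.inl (quadratic_cos_pos θ hs hs1).ne'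

lemma integral_displacementKernel_Ioo {a : ℝ} (ha0 : 0 < a) (ha1 : a < 1) :
    IntegrableOn (fun t => ∫ θ in (0 : ℝ)..2 * π, displacementKernel a θ t) (Ioo 0 1) ∧
    ∫ t in Ioo (0 : ℝ) 1, ∫ θ in (0 : ℝ)..2 * π, displacementKernel a θ t =
      2 * π * (a + 1) * (∑' n : ℕ, Ring.multichoose a n ^ 2 / (2 * n + a + 1) - 1 / (1 - a)) := by
  set G : ℝ → ℝ := fun t => ∫ θ in (0 : ℝ)..2 * π,
    ((t ^ (1 / (a + 1))) ^ 2 - 2 * cos θ * t ^ (1 / (a + 1)) + 1) ^ (-a)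
  let F : ℕ → ℝ → ℝ := fun n t => 2 * π * Ring.multichoose a n ^ 2 * t ^ (2 * n / (a + 1))
  have hexp : ∀ n : ℕ, -1 < 2 * n / (a + 1) := fun n =>
    neg_one_lt_zero.trans_le (by positivity)
  have hFi : ∀ n, IntegrableOn (F n) (Ioo 0 1) := fun n =>
    (integrableOn_rpow_Ioo (hexp n)).const_mul _
  have hFint : ∀ n, ∫ t in Ioo (0 : ℝ) 1, F n t =
      2 * π * (a + 1) * (Ring.multichoose a n ^ 2 / (2 * n + a + 1)) := by
    intro n
    simp only [F]
    rw [integral_const_mul, integral_rpow_Ioo (hexp n)]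
    field_simp
    ring
  have hsum : ∀ t ∈ Ioo (0 : ℝ) 1, HasSum (fun n => F n t) (G t) := by
    intro t ht
    have hr0 : 0 < t ^ (1 / (a + 1)) := rpow_pos_of_pos ht.1 _
    have hr1 : t ^ (1 / (a + 1)) < 1 := rpow_lt_one ht.1.le ht.2 (by positivity)
    convert hasSum_integral_rpow_neg a hr0.le hr1 using 2 with n
    simp only [F]
    rw [mul_pow, ← pow_mul, ← rpow_natCast (t ^ _), ← rpow_mul ht.1.le, ← mul_assoc]
    congr 2
    push_cast
    ring
  obtain ⟨hv, -, -⟩ := tsum_multichoose_sq_lt ha0 ha1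
  obtain ⟨hGi, hG⟩ := integrable_and_hasSum_integral_of_nonneg (μ := volume.restrict (Ioo 0 1))
    hFi
    (fun n => ae_restrict_of_forall_mem measurableSet_Ioo fun t ht => by
      have := rpow_nonneg ht.1.le (2 * n / (a + 1))
      simp only [F, Pi.zero_apply]
      positivity)
    (ae_restrict_of_forall_mem measurableSet_Ioo hsum)
    (by simpa only [hFint] using hv.mul_left _)
  have hq := integrableOn_rpow_Ioo (neg_one_lt_exponent ha0 ha1)
  have heq : ∀ t ∈ Ioo (0 : ℝ) 1, G t - 2 * π * t ^ (-(2 * a / (a + 1))) =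
      ∫ θ in (0 : ℝ)..2 * π, displacementKernel a θ t := by
    intro t ht
    have hr0 : 0 < t ^ (1 / (a + 1)) := rpow_pos_of_pos ht.1 _
    have hr1 : t ^ (1 / (a + 1)) < 1 := rpow_lt_one ht.1.le ht.2 (by positivity)
    unfold displacementKernel
    rw [intervalIntegral.integral_sub
      ((continuous_quadratic_cos_rpow a hr0.le hr1.ne).intervalIntegrable _ _)
      intervalIntegrable_const]
    simp [G]
  have hi : IntegrableOn (fun t => G t - 2 * π * t ^ (-(2 * a / (a + 1)))) (Ioo 0 1) :=
    Integrable.sub hGi (hq.const_mul _)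
  refine ⟨hi.congr_fun heq measurableSet_Ioo, ?_⟩
  rw [← setIntegral_congr_fun measurableSet_Ioo heq,
    integral_sub hGi (hq.const_mul _), hG, integral_const_mul,
    integral_rpow_Ioo (neg_one_lt_exponent ha0 ha1)]
  simp only [hFint]
  rw [tsum_mul_left]
  have h1a : 1 - a ≠ 0 := by linarith
  have e : -(2 * a / (a + 1)) + 1 = (1 - a) / (a + 1) := by field_simp; ring
  rw [e]
  field_simp

lemma integral_displacementKernel_Ioi {a : ℝ} (ha0 : 0 < a) (ha1 : a < 1) :
    IntegrableOn (fun t => ∫ θ in (0 : ℝ)..2 * π, displacementKernel a θ t) (Ioi 1) ∧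
    ∫ t in Ioi (1 : ℝ), ∫ θ in (0 : ℝ)..2 * π, displacementKernel a θ t =
      2 * π * (a + 1) * ∑' n : ℕ, Ring.multichoose a (n + 1) ^ 2 / (2 * n + a + 1) := by
  let F : ℕ → ℝ → ℝ := fun n t =>
    2 * π * Ring.multichoose a (n + 1) ^ 2 * t ^ (-((2 * a + 2 * (n + 1)) / (a + 1)))
  have hexp : ∀ n : ℕ, -((2 * a + 2 * (n + 1)) / (a + 1)) < -1 := fun n => by
    have hn : (0 : ℝ) ≤ n := n.cast_nonneg
    rw [neg_lt_neg_iff, one_lt_div (by linarith)]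
    linarith
  have hFi : ∀ n, IntegrableOn (F n) (Ioi 1) := fun n =>
    (integrableOn_Ioi_rpow_of_lt (hexp n) one_pos).const_mul _
  have hFint : ∀ n, ∫ t in Ioi (1 : ℝ), F n t =
      2 * π * (a + 1) * (Ring.multichoose a (n + 1) ^ 2 / (2 * n + a + 1)) := by
    intro n
    have e : -((2 * a + 2 * (n + 1)) / (a + 1)) + 1 = -((2 * n + a + 1) / (a + 1)) := by
      field_simp
      ring
    simp only [F]
    rw [integral_const_mul, integral_Ioi_rpow_of_lt (hexp n) one_pos, one_rpow, e]
    field_simp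
  have hsum : ∀ t ∈ Ioi (1 : ℝ),
      HasSum (fun n => F n t) (∫ θ in (0 : ℝ)..2 * π, displacementKernel a θ t) := by
    intro t ht
    have ht0 : 0 < t := zero_lt_one.trans ht
    set s := t ^ (-(1 / (a + 1))) with hs
    have hs0 : 0 < s := rpow_pos_of_pos ht0 _
    have hs1 : s < 1 := rpow_lt_one_of_one_lt_of_neg ht (neg_neg_of_pos (by positivity))
    have h := ((hasSum_nat_add_iff' 1).2 (hasSum_integral_rpow_neg a hs0.le hs1)).mul_left
      (t ^ (-(2 * a / (a + 1))))
    have hterm : ∀ n, F n t = t ^ (-(2 * a / (a + 1))) *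
        (2 * π * (Ring.multichoose a (n + 1) * s ^ (n + 1)) ^ 2) := by
      intro n
      have e : -((2 * a + 2 * ((n : ℝ) + 1)) / (a + 1)) =
          -(2 * a / (a + 1)) + -(1 / (a + 1)) * (((n + 1) * 2 : ℕ) : ℝ) := by
        push_cast
        ring
      simp only [F]
      rw [mul_pow, ← pow_mul s, hs, ← rpow_natCast (t ^ _), ← rpow_mul ht0.le, e, rpow_add ht0]
      ring
    have htotal : ∫ θ in (0 : ℝ)..2 * π, displacementKernel a θ t = t ^ (-(2 * a / (a + 1))) *
        ((∫ θ in (0 : ℝ)..2 * π, (s ^ 2 - 2 * cos θ * s + 1) ^ (-a)) -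
          ∑ i ∈ Finset.range 1, 2 * π * (Ring.multichoose a i * s ^ i) ^ 2) := by
      simp_rw [displacementKernel_eq_mul ht0]
      rw [intervalIntegral.integral_const_mul, intervalIntegral.integral_sub
        ((continuous_quadratic_cos_rpow a hs0.le hs1.ne).intervalIntegrable _ _)
        intervalIntegrable_const]
      simp [hs]
    simp_rw [hterm, htotal]
    exact h
  obtain ⟨-, hw, -⟩ := tsum_multichoose_sq_lt ha0 ha1
  obtain ⟨hi, hint⟩ := integrable_and_hasSum_integral_of_nonneg (μ := volume.restrict (Ioi 1))
    hFi
    (fun n => ae_restrict_of_forall_mem measurableSet_Ioi fun t ht => by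
      have := rpow_nonneg (zero_lt_one.trans ht).le (-((2 * a + 2 * ((n : ℝ) + 1)) / (a + 1)))
      simp only [F, Pi.zero_apply]
      positivity)
    (ae_restrict_of_forall_mem measurableSet_Ioi hsum)
    (by simpa only [hFint] using hw.mul_left _)
  refine ⟨hi, ?_⟩
  rw [hint]
  simp only [hFint]
  rw [tsum_mul_left]

lemma exists_integrableOn_lower_bound {a : ℝ} (ha0 : 0 < a) (ha1 : a < 1) :
    ∃ b : ℝ → ℝ, IntegrableOn b (Ioi 0) ∧
      ∀ t, 0 < t → t ≠ 1 → ∀ θ, -b t ≤ displacementKernel a θ t := by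
  refine ⟨fun t => if t < 1 then t ^ (-(2 * a / (a + 1)))
    else 3 * t ^ (-((2 * a + 1) / (a + 1))), integrableOn_Ioi_zero ?_ ?_, ?_⟩
  · refine (integrableOn_rpow_Ioo (neg_one_lt_exponent ha0 ha1)).congr_fun (fun t ht => ?_)
      measurableSet_Ioo
    simp [ht.2]
  · have h : IntegrableOn (fun t : ℝ => 3 * t ^ (-((2 * a + 1) / (a + 1)))) (Ioi 1) :=
      (integrableOn_Ioi_rpow_of_lt (exponent_lt_neg_one ha0) one_pos).const_mul 3
    refine h.congr_fun (fun t ht => ?_) measurableSet_Ioi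
    have ht' : (1 : ℝ) < t := ht
    simp [not_lt.2 ht'.le]
  · intro t ht ht1 θ
    rcases lt_or_gt_of_ne ht1 with h | h
    · simpa [h] using neg_le_displacementKernel (a := a) ht θ
    · simpa [not_lt.2 h.le] using neg_le_displacementKernel_of_one_lt ha0 ha1 h θ

lemma continuous_displacementKernel_left {a t : ℝ} (ha : 0 < a) (ht : 0 < t) (ht1 : t ≠ 1) :
    Continuous fun θ => displacementKernel a θ t := by
  have hr0 : 0 < t ^ (1 / (a + 1)) := rpow_pos_of_pos ht _
  have hr1 : t ^ (1 / (a + 1)) ≠ 1 := fun h => ht1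
    ((rpow_left_inj ht.le zero_le_one (z := 1 / (a + 1)) (by positivity)).1
      (h.trans (one_rpow _).symm))
  exact (continuous_quadratic_cos_rpow a hr0.le hr1).sub continuous_const

lemma integrable_uncurry_displacementKernel {a : ℝ} (ha0 : 0 < a) (ha1 : a < 1) :
    Integrable (Function.uncurry (displacementKernel a))
      ((volume.restrict (Ioc 0 (2 * π))).prod (volume.restrict (Ioi 0))) := by
  obtain ⟨b, hb, hlow⟩ := exists_integrableOn_lower_bound ha0 ha1
  have hH : IntegrableOn (fun t => ∫ θ in (0 : ℝ)..2 * π, displacementKernel a θ t) (Ioi 0) :=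
    integrableOn_Ioi_zero (integral_displacementKernel_Ioo ha0 ha1).1
      (integral_displacementKernel_Ioi ha0 ha1).1
  have hm := (measurable_displacementKernel a).aestronglyMeasurable
    (μ := (volume.restrict (Ioc 0 (2 * π))).prod (volume.restrict (Ioi 0)))
  have hae : ∀ᵐ t ∂volume.restrict (Ioi (0 : ℝ)), 0 < t ∧ t ≠ 1 :=
    (ae_restrict_mem measurableSet_Ioi).and
      (ae_restrict_of_ae (by simp [ae_iff, measure_singleton]))
  have h2π : (0 : ℝ) ≤ 2 * π := by positivity
  rw [integrable_prod_iff' hm]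
  constructor
  · filter_upwards [hae] with t ht
    exact ((continuous_displacementKernel_left ha0 ht.1 ht.2).intervalIntegrable 0 (2 * π)).1
  · refine Integrable.mono' (hH.add (hb.abs.const_mul (2 * π * 2)))
      hm.norm.prod_swap.integral_prod_right' ?_
    filter_upwards [hae] with t ht
    have hc := continuous_displacementKernel_left ha0 ht.1 ht.2
    simp only [Function.uncurry_apply_pair]
    rw [← intervalIntegral.integral_of_le h2π, norm_of_nonneg
      (intervalIntegral.integral_nonneg h2π fun θ _ => norm_nonneg _)]
    calc ∫ θ in (0 : ℝ)..2 * π, ‖displacementKernel a θ t‖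
        ≤ ∫ θ in (0 : ℝ)..2 * π, (displacementKernel a θ t + 2 * |b t|) := by
          refine intervalIntegral.integral_mono h2π (hc.norm.intervalIntegrable _ _)
            ((hc.add continuous_const).intervalIntegrable _ _) fun θ => ?_
          have h := hlow t ht.1 ht.2 θ
          rw [norm_eq_abs, abs_le]
          constructor <;> linarith [le_abs_self (b t), abs_nonneg (b t)]
      _ = _ := by
          rw [intervalIntegral.integral_add (hc.intervalIntegrable _ _) intervalIntegrable_const,
            intervalIntegral.integral_const]
          simp only [Pi.add_apply, smul_eq_mul, sub_zero]
          ring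

lemma integral_integral_displacementKernel_neg {a : ℝ} (ha0 : 0 < a) (ha1 : a < 1) :
    ∫ θ in (0 : ℝ)..2 * π, ∫ t in Ioi (0 : ℝ), displacementKernel a θ t < 0 := by
  obtain ⟨hi0, h0⟩ := integral_displacementKernel_Ioo ha0 ha1
  obtain ⟨hi1, h1⟩ := integral_displacementKernel_Ioi ha0 ha1
  obtain ⟨-, -, hlt⟩ := tsum_multichoose_sq_lt ha0 ha1
  have h2π : (0 : ℝ) ≤ 2 * π := by positivity
  rw [intervalIntegral.integral_of_le h2π,
    integral_integral_swap (integrable_uncurry_displacementKernel ha0 ha1)]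
  simp_rw [← intervalIntegral.integral_of_le h2π]
  rw [← Ioc_union_Ioi_eq_Ioi (zero_le_one (α := ℝ)), setIntegral_union (by simp) measurableSet_Ioi
    ((integrableOn_Ioc_iff_integrableOn_Ioo).2 hi0) hi1, integral_Ioc_eq_integral_Ioo, h0, h1,
    ← mul_add]
  exact mul_neg_of_pos_of_neg (by positivity) (by linarith)

lemma integrand_eq_displacementKernel {α t : ℝ} (hα : 0 < α) (ht : 0 < t) (θ : ℝ) :
    (t ^ (4 / (α + 2)) - 2 * cos θ * t ^ (2 / (α + 2)) + 1) ^ (-(α / 2)) -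
      t ^ (-(2 * α / (α + 2))) = displacementKernel (α / 2) θ t := by
  have e1 : 1 / (α / 2 + 1) = 2 / (α + 2) := by field_simp
  have e2 : 2 * (α / 2) / (α / 2 + 1) = 2 * α / (α + 2) := by field_simp
  have e3 : t ^ (4 / (α + 2)) = (t ^ (2 / (α + 2))) ^ 2 := by
    rw [← rpow_natCast, ← rpow_mul ht.le]
    congr 1
    push_cast
    ring
  rw [displacementKernel, e1, e2, e3]

theorem stmt_16 (α : ℝ) (hα : α ∈ Ioo (0:ℝ) 2) :
    (∀ θ : ℝ, Real.cos θ < 1 →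
      IntegrableOn
        (fun t : ℝ =>
          (t ^ (4 / (α + 2)) - 2 * Real.cos θ * t ^ (2 / (α + 2)) + 1) ^ (-(α / 2))
            - t ^ (-(2 * α / (α + 2))))
        (Ioi (0:ℝ))) ∧
    (∫ θ in (0:ℝ)..(2 * π),
        ∫ t in Ioi (0:ℝ),
          ((t ^ (4 / (α + 2)) - 2 * Real.cos θ * t ^ (2 / (α + 2)) + 1) ^ (-(α / 2))
            - t ^ (-(2 * α / (α + 2))))) < 0 := by
  have ha0 : 0 < α / 2 := half_pos hα.1
  have ha1 : α / 2 < 1 := by linarith [hα.2]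
  have heq : ∀ θ : ℝ, EqOn (fun t : ℝ =>
      (t ^ (4 / (α + 2)) - 2 * Real.cos θ * t ^ (2 / (α + 2)) + 1) ^ (-(α / 2))
        - t ^ (-(2 * α / (α + 2)))) (displacementKernel (α / 2) θ) (Ioi 0) :=
    fun θ t ht => integrand_eq_displacementKernel hα.1 ht θ
  refine ⟨fun θ hθ => (integrableOn_displacementKernel ha0 ha1 hθ).congr_fun (heq θ).symm
    measurableSet_Ioi, ?_⟩
  simp_rw [fun θ => setIntegral_congr_fun (μ := volume) measurableSet_Ioi (heq θ)]
  exact integral_integral_displacementKernel_neg ha0 ha1
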